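/- General energy for mean curvature flow of graphs with polynomial gradient reaction. Let $n \in \mathbb{Z}$, $T>0$, and let $u : [0,T]\times[0,1] \to \mathbb{R}$ be twice continuously differentiable with $u_x(t,x) > 0$ for all $(t,x)$, satisfying $u_t = u_{xx}\,(1+u_x^2)^{-3/2} + u_x^{\,n}$ on $[0,T]\times[0,1]$ and $u_t(t,0) = u_t(t,1) = 0$ for all $t$. Define, for $p > 0$, $\Lambda(p) := \int_1^p \int_1^{p_1} \frac{1}{p_2^{\,n}\,(1+p_2^2)^{3/2}}\,dp_2\,dp_1$. Then for every $t \in (0,T)$, the energy $E(t) := \int_0^1 \big( \Lambda(u_x(t,x)) - u(t,x) \big)\,dx$ is differentiable and $E'(t) = -\int_0^1 \frac{u_t(t,x)^2}{u_x(t,x)^{\,n}}\,dx$. -/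

import Mathlib

open Real Set

/-- Partial derivative of `u(t,x)` with respect to time `t`. -/
noncomputable def pt (u : ℝ → ℝ → ℝ) (t x : ℝ) : ℝ := deriv (fun s => u s x) t

/-- Partial derivative of `u(t,x)` with respect to space `x`. -/
noncomputable def px (u : ℝ → ℝ → ℝ) (t x : ℝ) : ℝ := deriv (fun y => u t y) x

/-- Second partial derivative of `u(t,x)` with respect to space `x`. -/
noncomputable def pxx (u : ℝ → ℝ → ℝ) (t x : ℝ) : ℝ := deriv (fun y => px u t y) x

/-- `Λ(p) := ∫₁^p ∫₁^{p₁} 1/(p₂ⁿ (1+p₂²)^{3/2}) dp₂ dp₁` for `p > 0`. -/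
noncomputable def Lam (n : ℤ) (p : ℝ) : ℝ :=
  ∫ p1 in (1:ℝ)..p, ∫ p2 in (1:ℝ)..p1, 1 / (p2 ^ n * (1 + p2 ^ 2) ^ ((3:ℝ)/2))

open MeasureTheory Topology

theorem hasDerivAt_slice_fst {g : ℝ × ℝ → ℝ} {t x : ℝ} (h : DifferentiableAt ℝ g (t, x)) :
    HasDerivAt (fun s => g (s, x)) (fderiv ℝ g (t, x) (1, 0)) t :=
  h.hasFDerivAt.comp_hasDerivAt t ((hasDerivAt_id t).prodMk (hasDerivAt_const t x))

theorem hasDerivAt_slice_snd {g : ℝ × ℝ → ℝ} {t x : ℝ} (h : DifferentiableAt ℝ g (t, x)) :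
    HasDerivAt (fun y => g (t, y)) (fderiv ℝ g (t, x) (0, 1)) x :=
  h.hasFDerivAt.comp_hasDerivAt x ((hasDerivAt_const x t).prodMk (hasDerivAt_id x))

section PartialDerivatives

variable {u : ℝ → ℝ → ℝ}

theorem pt_eq_fderiv (hu : Differentiable ℝ (fun q : ℝ × ℝ => u q.1 q.2)) :
    (fun q : ℝ × ℝ => pt u q.1 q.2) =
      fun q => fderiv ℝ (fun q : ℝ × ℝ => u q.1 q.2) q (1, 0) :=
  funext fun q => (hasDerivAt_slice_fst (hu (q.1, q.2))).deriv

theorem px_eq_fderiv (hu : Differentiable ℝ (fun q : ℝ × ℝ => u q.1 q.2)) :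
    (fun q : ℝ × ℝ => px u q.1 q.2) =
      fun q => fderiv ℝ (fun q : ℝ × ℝ => u q.1 q.2) q (0, 1) :=
  funext fun q => (hasDerivAt_slice_snd (hu (q.1, q.2))).deriv

theorem contDiff_pt (hu : ContDiff ℝ 2 (fun q : ℝ × ℝ => u q.1 q.2)) :
    ContDiff ℝ 1 (fun q : ℝ × ℝ => pt u q.1 q.2) := by
  rw [pt_eq_fderiv (hu.differentiable two_ne_zero)]
  exact (hu.fderiv_right (by norm_num)).clm_apply contDiff_const

theorem contDiff_px (hu : ContDiff ℝ 2 (fun q : ℝ × ℝ => u q.1 q.2)) :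
    ContDiff ℝ 1 (fun q : ℝ × ℝ => px u q.1 q.2) := by
  rw [px_eq_fderiv (hu.differentiable two_ne_zero)]
  exact (hu.fderiv_right (by norm_num)).clm_apply contDiff_const

theorem hasDerivAt_pt (hu : ContDiff ℝ 2 (fun q : ℝ × ℝ => u q.1 q.2)) (t x : ℝ) :
    HasDerivAt (fun s => u s x) (pt u t x) t :=
  (hasDerivAt_slice_fst (hu.differentiable two_ne_zero (t, x))).differentiableAt.hasDerivAt

theorem hasDerivAt_pxx (hu : ContDiff ℝ 2 (fun q : ℝ × ℝ => u q.1 q.2)) (t x : ℝ) :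
    HasDerivAt (fun y => px u t y) (pxx u t x) x :=
  (hasDerivAt_slice_snd
    ((contDiff_px hu).differentiable one_ne_zero (t, x))).differentiableAt.hasDerivAt

theorem continuous_pxx (hu : ContDiff ℝ 2 (fun q : ℝ × ℝ => u q.1 q.2)) :
    Continuous (fun q : ℝ × ℝ => pxx u q.1 q.2) := by
  have h : (fun q : ℝ × ℝ => pxx u q.1 q.2) =
      fun q => fderiv ℝ (fun q : ℝ × ℝ => px u q.1 q.2) q (0, 1) :=
    funext fun q => (hasDerivAt_slice_snd
      ((contDiff_px hu).differentiable one_ne_zero (q.1, q.2))).deriv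
  rw [h]
  exact ((contDiff_px hu).continuous_fderiv one_ne_zero).clm_apply continuous_const

/-- The mixed second derivative of a `C²` function exists, is continuous, and does not depend on
the order of differentiation. -/
theorem exists_continuous_mixed_deriv (hu : ContDiff ℝ 2 (fun q : ℝ × ℝ => u q.1 q.2)) :
    ∃ m : ℝ × ℝ → ℝ, Continuous m ∧
      (∀ t x, HasDerivAt (fun s => px u s x) (m (t, x)) t) ∧
      (∀ t x, HasDerivAt (fun y => pt u t y) (m (t, x)) x) := by
  have hd := hu.differentiable two_ne_zero
  refine ⟨fun q => fderiv ℝ (fun q : ℝ × ℝ => px u q.1 q.2) q (1, 0),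
    ((contDiff_px hu).continuous_fderiv one_ne_zero).clm_apply continuous_const,
    fun t x => hasDerivAt_slice_fst ((contDiff_px hu).differentiable one_ne_zero (t, x)),
    fun t x => ?_⟩
  have h := hasDerivAt_slice_snd ((contDiff_pt hu).differentiable one_ne_zero (t, x))
  have hf : DifferentiableAt ℝ (fderiv ℝ (fun q : ℝ × ℝ => u q.1 q.2)) (t, x) :=
    (hu.fderiv_right (m := 1) (by norm_num)).differentiable one_ne_zero _
  have hs : IsSymmSndFDerivAt ℝ (fun q : ℝ × ℝ => u q.1 q.2) (t, x) :=
    hu.contDiffAt.isSymmSndFDerivAt (by simp)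
  convert h using 1
  beta_reduce
  rw [pt_eq_fderiv hd, px_eq_fderiv hd, fderiv_clm_apply hf (differentiableAt_const _),
    fderiv_clm_apply hf (differentiableAt_const _)]
  simpa using hs (1, 0) (0, 1)

end PartialDerivatives

theorem hasDerivAt_integral_of_continuousOn_Ioi {f : ℝ → ℝ} {a p : ℝ}
    (hf : ContinuousOn f (Ioi 0)) (ha : 0 < a) (hp : 0 < p) :
    HasDerivAt (fun y => ∫ x in a..y, f x) (f p) p := by
  refine intervalIntegral.integral_hasDerivAt_right ?_
    (hf.stronglyMeasurableAtFilter isOpen_Ioi p hp) (hf.continuousAt (Ioi_mem_nhds hp))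
  exact (hf.mono fun x hx => lt_of_lt_of_le (lt_min ha hp) hx.1).intervalIntegrable

/-- There is a function `G` on `(0, ∞)` with `Λ' = G` and `G' (p) = p⁻ⁿ (1 + p²)^{-3/2}`. -/
theorem exists_deriv_Lam (n : ℤ) :
    ∃ G : ℝ → ℝ, (∀ p, 0 < p → HasDerivAt (Lam n) (G p) p) ∧
      ∀ p, 0 < p → HasDerivAt G (1 / (p ^ n * (1 + p ^ 2) ^ ((3:ℝ)/2))) p := by
  have hf : ContinuousOn (fun p : ℝ => 1 / (p ^ n * (1 + p ^ 2) ^ ((3:ℝ)/2))) (Ioi 0) := by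
    intro p hp
    have hp : (0:ℝ) < p := hp
    have h1 : (0:ℝ) < 1 + p ^ 2 := by positivity
    refine (ContinuousAt.div continuousAt_const ?_ (by positivity)).continuousWithinAt
    exact (continuousAt_zpow₀ p n (Or.inl hp.ne')).mul
      (ContinuousAt.rpow_const (by fun_prop) (Or.inl h1.ne'))
  have hG := fun p (hp : 0 < p) => hasDerivAt_integral_of_continuousOn_Ioi hf one_pos hp
  refine ⟨_, fun p hp => ?_, hG⟩
  exact hasDerivAt_integral_of_continuousOn_Ioi
    (fun p hp => (hG p hp).continuousAt.continuousWithinAt) one_pos hp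

/-- Differentiation under the integral sign over a compact interval, for an integrand whose
parameter derivative is jointly continuous. -/
theorem hasDerivAt_integral_of_continuousOn_deriv {F F' : ℝ → ℝ → ℝ} {a b c d t : ℝ}
    (hab : a ≤ b) (ht : t ∈ Ioo c d)
    (hF : ∀ s ∈ Icc c d, ContinuousOn (F s) (Icc a b))
    (hF' : ContinuousOn (fun q : ℝ × ℝ => F' q.1 q.2) (Icc c d ×ˢ Icc a b))
    (h : ∀ s ∈ Icc c d, ∀ x ∈ Icc a b, HasDerivAt (fun s => F s x) (F' s x) s) :
    HasDerivAt (fun s => ∫ x in a..b, F s x) (∫ x in a..b, F' t x) t := by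
  obtain ⟨C, hC⟩ := (isCompact_Icc.prod isCompact_Icc).exists_bound_of_continuousOn hF'
  have hsub : uIoc a b ⊆ Icc a b := by
    rw [uIoc_of_le hab]
    exact Ioc_subset_Icc_self
  have hmeas : ∀ f : ℝ → ℝ, ContinuousOn f (Icc a b) →
      AEStronglyMeasurable f (volume.restrict (uIoc a b)) := fun f hf =>
    (hf.mono hsub).aestronglyMeasurable measurableSet_uIoc
  have hcd : Ioo c d ⊆ Icc c d := Ioo_subset_Icc_self
  refine (intervalIntegral.hasDerivAt_integral_of_dominated_loc_of_deriv_le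
    (bound := fun _ => C) (Ioo_mem_nhds ht.1 ht.2) ?_ ?_ ?_ ?_ intervalIntegrable_const ?_).2
  · filter_upwards [Ioo_mem_nhds ht.1 ht.2] with s hs using hmeas _ (hF s (hcd hs))
  · exact (hF t (hcd ht)).intervalIntegrable_of_Icc hab
  · refine hmeas _ (hF'.comp (by fun_prop : ContinuousOn (fun x : ℝ => (t, x)) (Icc a b)) ?_)
    exact fun x hx => ⟨hcd ht, hx⟩
  · exact Filter.Eventually.of_forall fun x hx s hs => hC (s, x) ⟨hcd hs, hsub hx⟩
  · exact Filter.Eventually.of_forall fun x hx s hs => h s (hcd hs) x (hsub hx)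

/-- General energy for mean curvature flow of graphs with polynomial gradient reaction. -/
theorem energy_mcf_polynomial_reaction
    (n : ℤ) (T : ℝ) (hT : 0 < T)
    (u : ℝ → ℝ → ℝ)
    (hu : ContDiff ℝ 2 (fun q : ℝ × ℝ => u q.1 q.2))
    (hpos : ∀ t ∈ Icc (0:ℝ) T, ∀ x ∈ Icc (0:ℝ) 1, 0 < px u t x)
    (hPDE : ∀ t ∈ Icc (0:ℝ) T, ∀ x ∈ Icc (0:ℝ) 1,
      pt u t x = pxx u t x * (1 + (px u t x) ^ 2) ^ (-(3/2) : ℝ) + (px u t x) ^ n)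
    (hBC : ∀ t ∈ Icc (0:ℝ) T, pt u t 0 = 0 ∧ pt u t 1 = 0) :
    ∀ t ∈ Ioo (0:ℝ) T,
      HasDerivAt (fun s => ∫ x in (0:ℝ)..1, (Lam n (px u s x) - u s x))
        (-∫ x in (0:ℝ)..1, (pt u t x) ^ 2 / (px u t x) ^ n) t := by
  intro t ht
  have ht' : t ∈ Icc 0 T := Ioo_subset_Icc_self ht
  obtain ⟨G, hLam, hG⟩ := exists_deriv_Lam n
  obtain ⟨m, hm, hmt, hmx⟩ := exists_continuous_mixed_deriv hu
  have hcpx : Continuous (fun q : ℝ × ℝ => px u q.1 q.2) := (contDiff_px hu).continuous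
  have hcpt : Continuous (fun q : ℝ × ℝ => pt u q.1 q.2) := (contDiff_pt hu).continuous
  have hsl : Continuous fun x : ℝ => (t, x) := by fun_prop
  have hder := hasDerivAt_integral_of_continuousOn_deriv zero_le_one ht
    (F := fun s x => Lam n (px u s x) - u s x)
    (F' := fun s x => G (px u s x) * m (s, x) - pt u s x)
    (fun s hs x hx => by
      refine (ContinuousAt.sub ?_ ?_).continuousWithinAt
      · exact ContinuousAt.comp (f := fun y => px u s y) (hLam _ (hpos s hs x hx)).continuousAt
          (hasDerivAt_pxx hu s x).continuousAt
      · exact (hu.continuous.comp (by fun_prop : Continuous fun x : ℝ => (s, x))).continuousAt)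
    (fun q hq => by
      refine (ContinuousAt.sub (ContinuousAt.mul ?_ hm.continuousAt)
        hcpt.continuousAt).continuousWithinAt
      exact ContinuousAt.comp (f := fun q : ℝ × ℝ => px u q.1 q.2)
        (hG _ (hpos q.1 hq.1 q.2 hq.2)).continuousAt hcpx.continuousAt)
    (fun s hs x hx => by
      have h := (hLam _ (hpos s hs x hx)).comp s (hmt s x)
      exact h.sub (hasDerivAt_pt hu s x))
  convert hder using 1
  have hGd : ∀ x ∈ uIcc (0:ℝ) 1, HasDerivAt (fun x => G (px u t x))
      (1 / (px u t x ^ n * (1 + px u t x ^ 2) ^ ((3:ℝ)/2)) * pxx u t x) x := by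
    intro x hx
    rw [uIcc_of_le zero_le_one] at hx
    exact (hG _ (hpos t ht' x hx)).comp x (hasDerivAt_pxx hu t x)
  have hiG : IntervalIntegrable
      (fun x => 1 / (px u t x ^ n * (1 + px u t x ^ 2) ^ ((3:ℝ)/2)) * pxx u t x)
      volume 0 1 := by
    refine ContinuousOn.intervalIntegrable fun x hx => ?_
    rw [uIcc_of_le zero_le_one] at hx
    have hp := hpos t ht' x hx
    have h1 : (0:ℝ) < 1 + px u t x ^ 2 := by positivity
    have hc : ContinuousAt (fun x => px u t x) x := (hcpx.comp hsl).continuousAt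
    refine (ContinuousAt.mul (ContinuousAt.div continuousAt_const ?_ (by positivity))
      ((continuous_pxx hu).comp hsl).continuousAt).continuousWithinAt
    exact (hc.zpow₀ n (Or.inl hp.ne')).mul
      (ContinuousAt.rpow_const (by fun_prop) (Or.inl h1.ne'))
  have hipt : Continuous fun x => pt u t x := hcpt.comp hsl
  have him : IntervalIntegrable (fun x => m (t, x)) volume 0 1 :=
    (hm.comp hsl).intervalIntegrable _ _
  have hparts := intervalIntegral.integral_mul_deriv_eq_deriv_mul hGd
    (fun x _ => hmx t x) hiG him
  have hGc : ContinuousOn (fun x => G (px u t x)) (uIcc 0 1) :=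
    fun x hx => (hGd x hx).continuousAt.continuousWithinAt
  rw [intervalIntegral.integral_sub (him.continuousOn_mul hGc) (hipt.intervalIntegrable _ _),
    hparts, (hBC t ht').1, (hBC t ht').2, mul_zero, mul_zero, sub_zero, zero_sub, ← neg_add',
    ← intervalIntegral.integral_add (hiG.mul_continuousOn hipt.continuousOn)
      (hipt.intervalIntegrable _ _)]
  congr 1
  refine intervalIntegral.integral_congr fun x hx => ?_
  rw [uIcc_of_le zero_le_one] at hx
  have hp := hpos t ht' x hx
  have h1 : (0:ℝ) < 1 + px u t x ^ 2 := by positivity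
  have hpn : px u t x ^ n ≠ 0 := (zpow_pos hp n).ne'
  have hr : (1 + px u t x ^ 2) ^ ((3:ℝ)/2) ≠ 0 := (rpow_pos_of_pos h1 _).ne'
  have hpde := hPDE t ht' x hx
  rw [rpow_neg h1.le] at hpde
  have hpde' : pxx u t x =
      (pt u t x - px u t x ^ n) * (1 + px u t x ^ 2) ^ ((3:ℝ)/2) := by
    rw [hpde]
    field_simp
    ring
  simp only [hpde']
  field_simp
  ring
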